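/- arXiv:1107.5530 — 2 statements merged into one kernel-verified Lean document; each statement's English description precedes it below -/
import Mathlib

section
/- Let (M, N) be an orthogonal pair of Latin squares of order 4 (functions Fin 4 → Fin 4 → Fin 4). Then there exist permutations σ, τ of Fin 4 (reordering rows and columns) and permutations α, β of Fin 4 (relabeling symbols) such that, possibly after interchanging M and N, one has α(M(σ(i), τ(j))) = M₀(i,j) and β(N(σ(i), τ(j))) = N₀(i,j) for all i, j, where M₀ is the Latin square with rows (1,2,3,4), (2,1,4,3), (3,4,1,2), (4,3,2,1) and N₀ is the Latin square with rows (1,2,3,4), (3,4,1,2), (4,3,2,1), (2,1,4,3). In other words, (M₀, N₀) is the unique orthogonal pair of Latin squares of order 4 up to relabeling the symbols, reordering rows and columns, and swapping the two squares. -/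
/-- A Latin square of order `d`. -/
def IsLatinSquare {d : ℕ} (L : Fin d → Fin d → Fin d) : Prop :=
  (∀ i, Function.Bijective fun j => L i j) ∧ (∀ j, Function.Bijective fun i => L i j)

/-- Orthogonality of two Latin squares of order `d`. -/
def IsOrthogonal {d : ℕ} (L L' : Fin d → Fin d → Fin d) : Prop :=
  Function.Bijective fun q : Fin d × Fin d => (L q.1 q.2, L' q.1 q.2)

/-- The reference Latin square with rows (1,2,3,4), (2,1,4,3), (3,4,1,2),
(4,3,2,1); symbols are taken in `Fin 4` (so `4` denotes `0`). -/
def M₀ : Fin 4 → Fin 4 → Fin 4 :=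
  ![![1, 2, 3, 4], ![2, 1, 4, 3], ![3, 4, 1, 2], ![4, 3, 2, 1]]

/-- The reference Latin square with rows (1,2,3,4), (3,4,1,2), (4,3,2,1),
(2,1,4,3); symbols are taken in `Fin 4` (so `4` denotes `0`). -/
def N₀ : Fin 4 → Fin 4 → Fin 4 :=
  ![![1, 2, 3, 4], ![3, 4, 1, 2], ![4, 3, 2, 1], ![2, 1, 4, 3]]

/-- A Latin square of order four whose first row and column are those of `M₀`
is one of four squares, determined by the entries `(1, 1)` and `(2, 2)`. -/
theorem IsLatinSquare.eq_of_reduced {M : Fin 4 → Fin 4 → Fin 4} (hM : IsLatinSquare M)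
    (hrow : ∀ j, M 0 j = j + 1) (hcol : ∀ i, M i 0 = i + 1) :
    M = M₀ ∨
    M = ![![1, 2, 3, 0], ![2, 1, 0, 3], ![3, 0, 2, 1], ![0, 3, 1, 2]] ∨
    M = ![![1, 2, 3, 0], ![2, 3, 0, 1], ![3, 0, 1, 2], ![0, 1, 2, 3]] ∨
    M = ![![1, 2, 3, 0], ![2, 0, 1, 3], ![3, 1, 0, 2], ![0, 3, 2, 1]] := by
  have hM' : M = ![![1, 2, 3, 0], ![2, M 1 1, M 1 2, M 1 3], ![3, M 2 1, M 2 2, M 2 3],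
      ![0, M 3 1, M 3 2, M 3 3]] := by
    ext i j
    have := hrow j
    have := hcol i
    fin_cases i <;> fin_cases j <;> simp_all
  have entries : ∀ a b c : Fin 4, [2, a, b, c].Nodup → ∀ d e f : Fin 4, [3, d, e, f].Nodup →
      ∀ g h i : Fin 4, [0, g, h, i].Nodup →
      [2, a, d, g].Nodup → [3, b, e, h].Nodup → [0, c, f, i].Nodup →
      ![![1, 2, 3, 0], ![2, a, b, c], ![3, d, e, f], ![0, g, h, i]] = M₀ ∨
      ![![1, 2, 3, 0], ![2, a, b, c], ![3, d, e, f], ![0, g, h, i]] =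
        ![![1, 2, 3, 0], ![2, 1, 0, 3], ![3, 0, 2, 1], ![0, 3, 1, 2]] ∨
      ![![1, 2, 3, 0], ![2, a, b, c], ![3, d, e, f], ![0, g, h, i]] =
        ![![1, 2, 3, 0], ![2, 3, 0, 1], ![3, 0, 1, 2], ![0, 1, 2, 3]] ∨
      ![![1, 2, 3, 0], ![2, a, b, c], ![3, d, e, f], ![0, g, h, i]] =
        ![![1, 2, 3, 0], ![2, 0, 1, 3], ![3, 1, 0, 2], ![0, 3, 2, 1]] := by
    decide +kernel
  have row (i : Fin 4) : [M i 0, M i 1, M i 2, M i 3].Nodup :=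
    List.Nodup.map (hM.1 i).injective (l := [0, 1, 2, 3]) (by decide)
  have col (j : Fin 4) : [M 0 j, M 1 j, M 2 j, M 3 j].Nodup :=
    List.Nodup.map (hM.2 j).injective (l := [0, 1, 2, 3]) (by decide)
  have r1 := row 1
  have r2 := row 2
  have r3 := row 3
  have c1 := col 1
  have c2 := col 2
  have c3 := col 3
  simp only [hcol] at r1 r2 r3
  simp only [hrow] at c1 c2 c3
  rw [hM']
  exact entries _ _ _ r1 _ _ _ r2 _ _ _ r3 c1 c2 c3

/-- The cells of `N` carrying the symbol `k` form a transversal of `M`. -/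
theorem IsOrthogonal.exists_transversal {d : ℕ} {M N : Fin d → Fin d → Fin d}
    (hN : IsLatinSquare N) (hMN : IsOrthogonal M N) (k : Fin d) :
    ∃ c : Fin d → Fin d, (∀ i, N i (c i) = k) ∧ Function.Injective c ∧
      Function.Injective fun i => M i (c i) := by
  choose c hc using fun i => (hN.1 i).surjective k
  refine ⟨c, hc, fun i i' h => (hN.2 (c i)).injective ?_, fun i i' h => ?_⟩
  · exact (hc i).trans ((hc i').symm.trans (by simp [h]))
  · have := @Function.Bijective.injective _ _ _ hMN (i, c i) (i', c i')
      (Prod.ext h ((hc i).trans (hc i').symm))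
    exact congrArg Prod.fst this

/-- The three cyclic squares have no transversal, so only `M₀` has an orthogonal mate. -/
theorem IsOrthogonal.eq_of_reduced {M N : Fin 4 → Fin 4 → Fin 4} (hM : IsLatinSquare M)
    (hN : IsLatinSquare N) (hMN : IsOrthogonal M N) (hrow : ∀ j, M 0 j = j + 1)
    (hcol : ∀ i, M i 0 = i + 1) : M = M₀ := by
  obtain ⟨c, -, hc, hMc⟩ := hMN.exists_transversal hN 0
  rcases hM.eq_of_reduced hrow hcol with h | rfl | rfl | rfl
  · exact h
  all_goals
    clear * - hc hMc
    revert c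
    decide +kernel

theorem M₀_transversal {c : Fin 4 → Fin 4} (hc : Function.Injective c)
    (hMc : Function.Injective fun i => M₀ i (c i)) :
    (∀ i, M₀ (![0, 2, 3, 1] i) (c i) = c 0 + 1) ∨
      ∀ i, M₀ (![0, 3, 1, 2] i) (c i) = c 0 + 1 := by
  revert c
  decide +kernel

theorem IsOrthogonal.eq_or_eq_of_M₀ {N : Fin 4 → Fin 4 → Fin 4} (hN : IsLatinSquare N)
    (hMN : IsOrthogonal M₀ N) (hrow : ∀ j, N 0 j = j + 1) :
    (∀ i, N i = M₀ (![0, 2, 3, 1] i)) ∨ ∀ i, N i = M₀ (![0, 3, 1, 2] i) := by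
  choose c hNc hc hMc using hMN.exists_transversal hN
  have hc0 (k : Fin 4) : c k 0 + 1 = k := (hrow _).symm.trans (hNc k 0)
  have family (k : Fin 4) : (∀ i, M₀ (![0, 2, 3, 1] i) (c k i) = k) ∨
      ∀ i, M₀ (![0, 3, 1, 2] i) (c k i) = k := by
    simpa only [hc0] using M₀_transversal (hc k) (hMc k)
  have meet : ∀ k l : Fin 4, ∃ i, ∀ j j', M₀ (![0, 2, 3, 1] i) j = k →
      M₀ (![0, 3, 1, 2] i) j' = l → j = j' := by decide +kernel
  have eq_of_family {ρ : Fin 4 → Fin 4} (h : ∀ k i, M₀ (ρ i) (c k i) = k) (i : Fin 4) :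
      N i = M₀ (ρ i) := by
    ext1 j
    have hj : c (N i j) i = j := (hN.1 i).injective (hNc _ i)
    simpa only [hj] using (h (N i j) i).symm
  by_cases h : ∀ k i, M₀ (![0, 2, 3, 1] i) (c k i) = k
  · exact Or.inl (eq_of_family h)
  · obtain ⟨k, hk⟩ := not_forall.mp h
    refine Or.inr (eq_of_family fun l => (family l).resolve_left fun hl => hk ?_)
    have hk' := (family k).resolve_left hk
    obtain ⟨i, hi⟩ := meet l k
    have hlk : l = k := by
      rw [← hNc l i, ← hNc k i, hi _ _ (hl i) (hk' i)]
    exact hlk ▸ hl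

theorem IsLatinSquare.isotope {d : ℕ} {L : Fin d → Fin d → Fin d} (hL : IsLatinSquare L)
    (σ α : Equiv.Perm (Fin d)) : IsLatinSquare fun i j => α (L (σ i) j) :=
  ⟨fun i => α.bijective.comp (hL.1 (σ i)),
    fun j => α.bijective.comp ((hL.2 j).comp σ.bijective)⟩

theorem IsOrthogonal.isotope {d : ℕ} {M N : Fin d → Fin d → Fin d} (h : IsOrthogonal M N)
    (σ α β : Equiv.Perm (Fin d)) :
    IsOrthogonal (fun i j => α (M (σ i) j)) fun i j => β (N (σ i) j) :=
  (α.prodCongr β).bijective.comp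
    (Function.Bijective.comp h (σ.prodCongr (Equiv.refl _)).bijective)

/-- `(M₀, N₀)` is the unique orthogonal pair of Latin squares of order 4 up to
relabeling the symbols, reordering rows and columns, and swapping the two
squares. -/
theorem ols_order_four_unique (M N : Fin 4 → Fin 4 → Fin 4)
    (hM : IsLatinSquare M) (hN : IsLatinSquare N) (hMN : IsOrthogonal M N) :
    ∃ σ τ α β : Equiv.Perm (Fin 4),
      (∀ i j, α (M (σ i) (τ j)) = M₀ i j ∧ β (N (σ i) (τ j)) = N₀ i j) ∨
      (∀ i j, α (N (σ i) (τ j)) = M₀ i j ∧ β (M (σ i) (τ j)) = N₀ i j) := by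
  let m := Equiv.ofBijective _ (hM.1 0)
  let n := Equiv.ofBijective _ (hN.1 0)
  let α : Equiv.Perm (Fin 4) := m.symm.trans (Equiv.addRight 1)
  let β : Equiv.Perm (Fin 4) := n.symm.trans (Equiv.addRight 1)
  let p := Equiv.ofBijective _ (hM.2 0)
  let σ : Equiv.Perm (Fin 4) := ((Equiv.addRight 1).trans α.symm).trans p.symm
  have hα (j : Fin 4) : α (M 0 j) = j + 1 := congrArg (· + 1) (m.symm_apply_apply j)
  have hβ (j : Fin 4) : β (N 0 j) = j + 1 := congrArg (· + 1) (n.symm_apply_apply j)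
  have hcol (i : Fin 4) : α (M (σ i) 0) = i + 1 := by
    have : M (σ i) 0 = α.symm (i + 1) := p.apply_symm_apply _
    rw [this, Equiv.apply_symm_apply]
  have hσ : σ 0 = 0 := (hM.2 0).injective (α.injective (by simp only [hcol, hα]))
  have hMN' := hMN.isotope σ α β
  have hN' := hN.isotope σ β
  have hM₀ := hMN'.eq_of_reduced (hM.isotope σ α) hN' (fun j => by simp only [hσ, hα]) hcol
  rw [hM₀] at hMN'
  have hMα (i j : Fin 4) : α (M (σ i) j) = M₀ i j := congrFun₂ hM₀ i j
  rcases hMN'.eq_or_eq_of_M₀ hN' (fun j => by simp only [hσ, hβ]) with h | h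
  · refine ⟨σ, 1, α, β, Or.inl fun i j => ⟨hMα i j, (congrFun (h i) j).trans ?_⟩⟩
    decide +revert
  · let ρ : Equiv.Perm (Fin 4) := ⟨![0, 2, 3, 1], ![0, 3, 1, 2], by decide, by decide⟩
    refine ⟨ρ.trans σ, 1, β, α, Or.inr fun i j => ⟨(congrFun (h (ρ i)) j).trans ?_,
      (hMα (ρ i) j).trans ?_⟩⟩
    · exact congrFun (congrArg M₀ (ρ.symm_apply_apply i)) j
    · clear * -
      decide +revert
end

section
/- For (a, b, c) ∈ ℂ³ \ {0}, define the polynomials F = a(t − t²) + b(t² − t⁴) + c t⁴, G = a(t³ + t²) + b − c t³ and H = a t² + b t⁵ + c in ℂ[t] (the entries of T(t)·(a,b,c)ᵀ), and whenever F, G, H are all nonzero set ψ(a:b:c) = (deg H − deg F, deg H − deg G) ∈ ℤ². Then: ψ(0:0:1) = (−4,−3); ψ(0:1:0) = (1,5); ψ(1:0:0) = (0,−1); ψ(1:1:1) = (4,3); ψ(1:0:1) = (−2,0); ψ(a:1:1) = (3,2) for every a ≠ 1; ψ(a:0:1) = (−2,−1) for every a ∉ {0,1}; ψ(1:b:1)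 = (1,3) for every b ∉ {0,1}; and ψ(a:b:c) = (1,2) whenever b ≠ 0, b ≠ c and a ≠ c. In particular, for each of the five values (−4,−3), (1,5), (0,−1), (4,3), (−2,0), the preimage ψ⁻¹ of that value consists of a single point of the dual projective plane (ℙ²)* (the triples (a,b,c) attaining it are uniquely determined up to a nonzero scalar). -/
open Polynomial

noncomputable section

/-- First entry of `T(t)·(a,b,c)ᵀ`: `a(t - t²) + b(t² - t⁴) + c t⁴`. -/
def Fp (a b c : ℂ) : Polynomial ℂ :=
  C a * (X - X ^ 2) + C b * (X ^ 2 - X ^ 4) + C c * X ^ 4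

/-- Second entry of `T(t)·(a,b,c)ᵀ`: `a(t³ + t²) + b - c t³`. -/
def Gp (a b c : ℂ) : Polynomial ℂ :=
  C a * (X ^ 3 + X ^ 2) + C b - C c * X ^ 3

/-- Third entry of `T(t)·(a,b,c)ᵀ`: `a t² + b t⁵ + c`. -/
def Hp (a b c : ℂ) : Polynomial ℂ :=
  C a * X ^ 2 + C b * X ^ 5 + C c

/-- The center `(deg H - deg F, deg H - deg G)` of the tropical line obtained by
tropicalizing the family of lines with dual coordinates `T(t)·(a,b,c)ᵀ`. -/
def ψ (a b c : ℂ) : ℤ × ℤ :=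
  (((Hp a b c).natDegree : ℤ) - ((Fp a b c).natDegree : ℤ),
   ((Hp a b c).natDegree : ℤ) - ((Gp a b c).natDegree : ℤ))

theorem natDegree_Fp (a b c : ℂ) :
    (Fp a b c).natDegree = if c ≠ b then 4 else if b ≠ a then 2 else if a ≠ 0 then 1 else 0 := by
  have h : Fp a b c = C (c - b) * X ^ 4 + C (b - a) * X ^ 2 + C a * X := by
    simp only [Fp, C_sub]
    ring
  rw [h]
  split_ifs with hcb hba ha
  · have := sub_ne_zero.mpr hcb
    compute_degree!
  · obtain rfl := not_ne_iff.mp hcb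
    have := sub_ne_zero.mpr hba
    simp only [sub_self, C_0, zero_mul, zero_add]
    compute_degree!
  · obtain rfl := not_ne_iff.mp hcb
    obtain rfl := not_ne_iff.mp hba
    simp [ha]
  · simp_all

theorem natDegree_Gp (a b c : ℂ) :
    (Gp a b c).natDegree = if a ≠ c then 3 else if a ≠ 0 then 2 else 0 := by
  have h : Gp a b c = C (a - c) * X ^ 3 + C a * X ^ 2 + C b := by
    simp only [Gp, C_sub]
    ring
  rw [h]
  split_ifs with hac ha
  · have := sub_ne_zero.mpr hac
    compute_degree!
  · obtain rfl := not_ne_iff.mp hac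
    simp only [sub_self, C_0, zero_mul, zero_add]
    compute_degree!
  · simp_all

theorem natDegree_Hp (a b c : ℂ) :
    (Hp a b c).natDegree = if b ≠ 0 then 5 else if a ≠ 0 then 2 else 0 := by
  unfold Hp
  split_ifs with hb ha
  · compute_degree!
  · obtain rfl := not_ne_iff.mp hb
    simp only [C_0, zero_mul, add_zero]
    compute_degree!
  · simp_all

/-- The table of centers of tropicalized lines: the values of `ψ` on the special
dual points, on the special one-parameter families, and on generic dual points;
in particular each of the five values `(-4,-3)`, `(1,5)`, `(0,-1)`, `(4,3)`,
`(-2,0)` is attained by a unique point of `(ℙ²)*` (the triples attaining it are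
determined up to a nonzero scalar). -/
theorem psi_values :
    (ψ 0 0 1 = (-4, -3) ∧ ψ 0 1 0 = (1, 5) ∧ ψ 1 0 0 = (0, -1) ∧
      ψ 1 1 1 = (4, 3) ∧ ψ 1 0 1 = (-2, 0)) ∧
    (∀ a : ℂ, a ≠ 1 → ψ a 1 1 = (3, 2)) ∧
    (∀ a : ℂ, a ≠ 0 → a ≠ 1 → ψ a 0 1 = (-2, -1)) ∧
    (∀ b : ℂ, b ≠ 0 → b ≠ 1 → ψ 1 b 1 = (1, 3)) ∧
    (∀ a b c : ℂ, b ≠ 0 → b ≠ c → a ≠ c → ψ a b c = (1, 2)) ∧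
    (∀ a b c : ℂ, ¬(a = 0 ∧ b = 0 ∧ c = 0) → ψ a b c = (-4, -3) →
      ∃ l : ℂ, l ≠ 0 ∧ a = l * 0 ∧ b = l * 0 ∧ c = l * 1) ∧
    (∀ a b c : ℂ, ¬(a = 0 ∧ b = 0 ∧ c = 0) → ψ a b c = (1, 5) →
      ∃ l : ℂ, l ≠ 0 ∧ a = l * 0 ∧ b = l * 1 ∧ c = l * 0) ∧
    (∀ a b c : ℂ, ¬(a = 0 ∧ b = 0 ∧ c = 0) → ψ a b c = (0, -1) →
      ∃ l : ℂ, l ≠ 0 ∧ a = l * 1 ∧ b = l * 0 ∧ c = l * 0) ∧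
    (∀ a b c : ℂ, ¬(a = 0 ∧ b = 0 ∧ c = 0) → ψ a b c = (4, 3) →
      ∃ l : ℂ, l ≠ 0 ∧ a = l * 1 ∧ b = l * 1 ∧ c = l * 1) ∧
    (∀ a b c : ℂ, ¬(a = 0 ∧ b = 0 ∧ c = 0) → ψ a b c = (-2, 0) →
      ∃ l : ℂ, l ≠ 0 ∧ a = l * 1 ∧ b = l * 0 ∧ c = l * 1) := by
  simp only [ψ, natDegree_Fp, natDegree_Gp, natDegree_Hp, Prod.mk.injEq]
  refine ⟨by norm_num, ?_, ?_, ?_, ?_, ?_, ?_, ?_, ?_, ?_⟩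
  · intro a ha
    simp [ha, ha.symm]
  · intro a h0 h1
    simp [h0, h1]
  · intro b h0 h1
    simp [h0, h1.symm]
  · intro a b c hb hbc hac
    simp [hb, hbc.symm, hac]
  · intro a b c h0 h
    exact ⟨c, by grind⟩
  · intro a b c h0 h
    exact ⟨b, by grind⟩
  · intro a b c h0 h
    exact ⟨a, by grind⟩
  · intro a b c h0 h
    exact ⟨a, by grind⟩
  · intro a b c h0 h
    exact ⟨a, by grind⟩

end
end
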